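/- Let x be the sum of (−1)^{v(T)} over spanning trees T of G containing e, and let y be the sum of (−1)^{v(T)} over spanning trees T of G not containing e. If |x + y| = |x| + |y|, then for every n ≥ 1 the absolute value of the sum of (−1)^{v(T')} over all spanning trees T' of G^n equals the absolute value of the corresponding sum over all spanning trees of G^{n−1} plus |y| (where G^0 is interpreted as G itself). -/

import Mathlib

open Sum

/-- The set of spanning trees of a simple graph `H`: subgraphs (on the full
vertex set) that are trees. -/
def spanningTrees {X : Type*} (H : SimpleGraph X) : Set (SimpleGraph X) :=
  {T | T ≤ H ∧ T.IsTree}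

/-- The number of positive edges of `T` with respect to the sign function `σ`. -/
noncomputable def posCount {X : Type*} (σ : Sym2 X → ℤ) (T : SimpleGraph X) : ℕ :=
  {ed | ed ∈ T.edgeSet ∧ σ ed = 1}.ncard

/-- The graph `G^n`: delete the edge `{u, v}` and insert a path
`u — w₁ — ⋯ — wₙ — v` through `n` new vertices. -/
def subdiv {V : Type*} (G : SimpleGraph V) (u v : V) (n : ℕ) :
    SimpleGraph (V ⊕ Fin n) :=
  SimpleGraph.fromRel fun a b =>
    match a, b with
    | inl a, inl b => G.Adj a b ∧ s(a, b) ≠ s(u, v)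
    | inl a, inr i => (a = u ∧ (i : ℕ) = 0) ∨ (a = v ∧ (i : ℕ) = n - 1)
    | inr i, inr j => (j : ℕ) = (i : ℕ) + 1
    | inr _, inl _ => False

/-- The sign function on `G^n`: old edges keep their signs, and all
new (path) edges are positive. -/
noncomputable def subdivSign {V : Type*} {n : ℕ} (σ : Sym2 V → ℤ) :
    Sym2 (V ⊕ Fin n) → ℤ :=
  Sym2.lift ⟨fun a b =>
    match a, b with
    | inl a, inl b => σ s(a, b)
    | _, _ => (1 : ℤ),
    by rintro (a | i) (b | j) <;> simp only [] <;> rw [Sym2.eq_swap]⟩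

/-- The signed spanning-tree sum of `G^n`, with `G^0` interpreted as `G`
itself. -/
noncomputable def twistSum {V : Type*} (G : SimpleGraph V) (σ : Sym2 V → ℤ)
    (u v : V) : ℕ → ℤ
  | 0 => ∑ᶠ T ∈ spanningTrees G, (-1 : ℤ) ^ posCount σ T
  | n + 1 => ∑ᶠ T' ∈ spanningTrees (subdiv G u v (n + 1)),
      (-1 : ℤ) ^ posCount (subdivSign σ) T'


/-- `H'` (on `X'`) is obtained from `H` by subdividing the edge `ab` with the new vertex `w`. -/
structure SubdivRel {X X' : Type*} (f : X → X') (w : X') (a b : X) (T : SimpleGraph X)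
    (T' : SimpleGraph X') : Prop where
  old : ∀ p q, T'.Adj (f p) (f q) ↔ T.Adj p q ∧ s(p, q) ≠ s(a, b)
  new : ∀ p, T'.Adj w (f p) ↔ p = a ∨ (p = b ∧ T.Adj a b)

section
variable {X X' : Type*} {f : X → X'} {w : X'} {a b : X}

lemma SubdivRel.connected {T : SimpleGraph X} {T' : SimpleGraph X'}
    (hX : ∀ z, z = w ∨ ∃ p, z = f p) (hf : Function.Injective f) (hw : ∀ p, f p ≠ w)
    (h : SubdivRel f w a b T T') : T'.Connected ↔ T.Connected := by
  classical
  constructor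
  · intro hc
    let g : X' → X := fun z => if hz : ∃ p, z = f p then hz.choose else a
    have gf : ∀ p, g (f p) = p := by
      intro p
      have hz : ∃ q, f p = f q := ⟨p, rfl⟩
      simp only [g, dif_pos hz]
      exact (hf hz.choose_spec).symm
    have gw : g w = a := by
      simp only [g]
      rw [dif_neg]
      rintro ⟨p, hp⟩
      exact hw p hp.symm
    have key : ∀ z z', T'.Adj z z' → T.Reachable (g z) (g z') := by
      intro z z' hz
      rcases hX z with rfl | ⟨p, rfl⟩ <;> rcases hX z' with rfl | ⟨q, rfl⟩
      · exact absurd hz (T'.irrefl)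
      · rw [gw, gf]
        rcases (h.new q).1 hz with rfl | ⟨rfl, h2⟩
        · exact .refl _
        · exact h2.reachable
      · rw [gw, gf]
        rcases (h.new p).1 hz.symm with rfl | ⟨rfl, h2⟩
        · exact .refl _
        · exact h2.symm.reachable
      · rw [gf, gf]
        exact ((h.old p q).1 hz).1.reachable
    have key2 : ∀ z z', T'.Reachable z z' → T.Reachable (g z) (g z') := by
      rintro z z' ⟨p⟩
      induction p with
      | nil => exact .refl _
      | cons h1 _ ih => exact (key _ _ h1).trans ih
    have : Nonempty X := ⟨a⟩
    refine ⟨fun p q => ?_⟩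
    have := key2 _ _ (hc.preconnected (f p) (f q))
    rwa [gf, gf] at this
  · intro hc
    have key : ∀ p q, T.Adj p q → T'.Reachable (f p) (f q) := by
      intro p q hpq
      by_cases he : s(p, q) = s(a, b)
      · have hab : T.Adj a b := by
          rw [← SimpleGraph.mem_edgeSet, ← he]; exact hpq
        have h1 : T'.Reachable (f a) (f b) :=
          ((h.new a).2 (Or.inl rfl)).reachable.symm.trans
            ((h.new b).2 (Or.inr ⟨rfl, hab⟩)).reachable
        rcases Sym2.eq_iff.1 he with ⟨rfl, rfl⟩ | ⟨rfl, rfl⟩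
        · exact h1
        · exact h1.symm
      · exact ((h.old p q).2 ⟨hpq, he⟩).reachable
    have key2 : ∀ z z', T.Reachable z z' → T'.Reachable (f z) (f z') := by
      rintro z z' ⟨p⟩
      induction p with
      | nil => exact .refl _
      | cons h1 _ ih => exact (key _ _ h1).trans ih
    have key3 : ∀ z, T'.Reachable (f a) z := by
      intro z
      rcases hX z with rfl | ⟨p, rfl⟩
      · exact ((h.new a).2 (Or.inl rfl)).reachable.symm
      · exact key2 _ _ (hc.preconnected a p)
    have : Nonempty X' := ⟨w⟩
    exact ⟨fun p q => (key3 p).symm.trans (key3 q)⟩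

lemma SubdivRel.posCount [Finite X] {T : SimpleGraph X} {T' : SimpleGraph X'}
    (hX : ∀ z, z = w ∨ ∃ p, z = f p) (hf : Function.Injective f) (hw : ∀ p, f p ≠ w)
    (hab : a ≠ b)
    (h : SubdivRel f w a b T T') (σ : Sym2 X → ℤ) (σ' : Sym2 X' → ℤ)
    (h1 : ∀ p q, σ' s(f p, f q) = σ s(p, q)) (h2 : ∀ p, σ' s(w, f p) = 1)
    (h3 : σ s(a, b) = 1) :
    posCount σ' T' = posCount σ T + 1 := by
  classical
  let g : Sym2 X → Sym2 X' := fun e => if e = s(a, b) then s(w, f b) else Sym2.map f e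
  have hwm : ∀ e : Sym2 X, w ∉ Sym2.map f e := by
    intro e he
    obtain ⟨p, _, hp⟩ := Sym2.mem_map.1 he
    exact hw p hp
  have hg : Function.Injective g := by
    intro e e' hee
    simp only [g] at hee
    split_ifs at hee with i j j
    · rw [i, j]
    · exact absurd (hee ▸ Sym2.mem_mk_left _ _) (hwm e')
    · exact absurd (hee ▸ Sym2.mem_mk_left _ _) (hwm e)
    · exact Sym2.map.injective hf hee
  have hset : {ed | ed ∈ T'.edgeSet ∧ σ' ed = 1} =
      insert s(w, f a) (g '' {ed | ed ∈ T.edgeSet ∧ σ ed = 1}) := by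
    ext e
    constructor
    · have main : ∀ p, T'.Adj w (f p) → s(w, f p) ∈
          insert s(w, f a) (g '' {ed | ed ∈ T.edgeSet ∧ σ ed = 1}) := by
        intro p hp
        rcases (h.new p).1 hp with rfl | ⟨rfl, h5⟩
        · exact Set.mem_insert _ _
        · refine Set.mem_insert_of_mem _ ⟨s(a, p), ⟨h5, h3⟩, ?_⟩
          simp [g]
      induction e with
      | _ z z' =>
      rintro ⟨he, hs⟩
      rw [SimpleGraph.mem_edgeSet] at he
      rcases hX z with rfl | ⟨p, rfl⟩ <;> rcases hX z' with rfl | ⟨q, rfl⟩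
      · exact absurd he (T'.irrefl)
      · exact main q he
      · exact Sym2.eq_swap (a := f p) ▸ main p he.symm
      · obtain ⟨h5, h6⟩ := (h.old p q).1 he
        refine Set.mem_insert_of_mem _ ⟨s(p, q), ⟨h5, (h1 p q) ▸ hs⟩, ?_⟩
        simp only [g, if_neg h6, Sym2.map_mk]
    · rintro (rfl | ⟨e, ⟨he, hs⟩, rfl⟩)
      · exact ⟨(h.new a).2 (Or.inl rfl), h2 a⟩
      · by_cases i : e = s(a, b)
        · subst i
          simp only [g, if_true]
          exact ⟨(h.new b).2 (Or.inr ⟨rfl, he⟩), h2 b⟩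
        · simp only [g, if_neg i]
          induction e with
          | _ p q =>
          exact ⟨(h.old p q).2 ⟨he, i⟩, (h1 p q).trans hs⟩
  unfold _root_.posCount
  rw [hset, Set.ncard_insert_of_notMem, Set.ncard_image_of_injective _ hg]
  · rintro ⟨e, _, he⟩
    simp only [g] at he
    split_ifs at he with i
    · rw [Sym2.congr_right] at he
      exact hab (hf he).symm
    · exact hwm e (he ▸ Sym2.mem_mk_left _ _)

lemma posCount_one (T : SimpleGraph X) : posCount (fun _ => 1) T = Nat.card T.edgeSet := by
  simp [posCount, Nat.card_coe_set_eq]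

lemma SubdivRel.isTree [Finite X] {T : SimpleGraph X} {T' : SimpleGraph X'}
    (hX : ∀ z, z = w ∨ ∃ p, z = f p) (hf : Function.Injective f) (hw : ∀ p, f p ≠ w)
    (hab : a ≠ b)
    (h : SubdivRel f w a b T T') : T'.IsTree ↔ T.IsTree := by
  classical
  have hu : (Set.univ : Set X') = insert w (Set.range f) := by
    ext z
    simp only [Set.mem_univ, Set.mem_insert_iff, Set.mem_range, true_iff]
    rcases hX z with h | ⟨p, h⟩
    · exact Or.inl h
    · exact Or.inr ⟨p, h.symm⟩
  have : Finite X' := by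
    rw [← Set.finite_univ_iff, hu]
    exact (Set.finite_range f).insert w
  have hcard : Nat.card X' = Nat.card X + 1 := by
    rw [← Set.ncard_univ, hu, Set.ncard_insert_of_notMem, ← Set.image_univ,
      Set.ncard_image_of_injective _ hf, Set.ncard_univ]
    rintro ⟨p, hp⟩
    exact hw p hp
  have hp := h.posCount hX hf hw hab (fun _ => 1) (fun _ => 1) (fun _ _ => rfl) (fun _ => rfl) rfl
  rw [posCount_one, posCount_one] at hp
  rw [SimpleGraph.isTree_iff_connected_and_card, SimpleGraph.isTree_iff_connected_and_card,
    h.connected hX hf hw, hp, hcard]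
  simp

lemma SubdivRel.exists_up (T : SimpleGraph X) (hf : Function.Injective f) (hw : ∀ p, f p ≠ w) :
    ∃ T', SubdivRel f w a b T T' := by
  refine ⟨⟨fun z z' => (∃ p q, z = f p ∧ z' = f q ∧ T.Adj p q ∧ s(p, q) ≠ s(a, b)) ∨
    (z = w ∧ ∃ p, z' = f p ∧ (p = a ∨ (p = b ∧ T.Adj a b))) ∨
    (z' = w ∧ ∃ p, z = f p ∧ (p = a ∨ (p = b ∧ T.Adj a b))), ?_, ?_⟩, ?_, ?_⟩
  · constructor
    rintro z z' (⟨p, q, h1, h2, h3, h4⟩ | h | h)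
    · exact Or.inl ⟨q, p, h2, h1, h3.symm, by rwa [Sym2.eq_swap]⟩
    · exact Or.inr (Or.inr h)
    · exact Or.inr (Or.inl h)
  · constructor
    rintro z (⟨p, q, h1, h2, h3, h4⟩ | ⟨h, p, h2, _⟩ | ⟨h, p, h2, _⟩)
    · have : p = q := hf (h1 ▸ h2)
      exact h3.ne this
    · exact hw p (h2 ▸ h)
    · exact hw p (h2 ▸ h)
  · intro p q
    constructor
    · rintro (⟨p', q', h1, h2, h3⟩ | ⟨h, _⟩ | ⟨h, _⟩)
      · rw [hf h1, hf h2]; exact h3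
      · exact absurd h (hw _)
      · exact absurd h (hw _)
    · intro h
      exact Or.inl ⟨p, q, rfl, rfl, h⟩
  · intro p
    constructor
    · rintro (⟨p', q', h1, h2, h3⟩ | ⟨_, q, h1, h2⟩ | ⟨h, _⟩)
      · exact absurd h1.symm (hw _)
      · rw [hf h1]; exact h2
      · exact absurd h (hw _)
    · intro h
      exact Or.inr (Or.inl ⟨rfl, p, rfl, h⟩)

lemma SubdivRel.le {T H : SimpleGraph X} {T' H' : SimpleGraph X'}
    (hX : ∀ z, z = w ∨ ∃ p, z = f p)
    (h : SubdivRel f w a b T T') (h' : SubdivRel f w a b H H') (hTH : T ≤ H) : T' ≤ H' := by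
  have main : ∀ p, T'.Adj w (f p) → H'.Adj w (f p) := by
    intro p hp
    rw [h.new] at hp
    rw [h'.new]
    exact hp.imp id (fun h => ⟨h.1, hTH h.2⟩)
  intro z z' hz
  rcases hX z with rfl | ⟨p, rfl⟩ <;> rcases hX z' with rfl | ⟨q, rfl⟩
  · exact absurd hz (T'.irrefl)
  · exact main q hz
  · exact (main p hz.symm).symm
  · rw [h.old] at hz
    rw [h'.old]
    exact ⟨hTH hz.1, hz.2⟩

lemma SubdivRel.adj_iff {T : SimpleGraph X} {T' : SimpleGraph X'} (hab : a ≠ b)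
    (h : SubdivRel f w a b T T') (p q : X) :
    T.Adj p q ↔ T'.Adj (f p) (f q) ∨ (s(p, q) = s(a, b) ∧ T'.Adj w (f b)) := by
  rw [h.old, h.new]
  by_cases he : s(p, q) = s(a, b)
  · have : T.Adj p q ↔ T.Adj a b := by
      rw [← SimpleGraph.mem_edgeSet, he, SimpleGraph.mem_edgeSet]
    simp [he, this, hab.symm]
  · simp [he]

lemma SubdivRel.exists_down {H : SimpleGraph X} {H' T' : SimpleGraph X'} (hab : H.Adj a b)
    (h : SubdivRel f w a b H H') (hT : T' ≤ H') (hwa : T'.Adj w (f a)) :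
    ∃ T ≤ H, SubdivRel f w a b T T' := by
  have hno : ¬ T'.Adj (f a) (f b) := fun hh => ((h.old a b).1 (hT hh)).2 rfl
  refine ⟨⟨fun p q => T'.Adj (f p) (f q) ∨ (s(p, q) = s(a, b) ∧ T'.Adj w (f b)), ?_, ?_⟩,
    ?_, ?_, ?_⟩
  · constructor
    rintro p q (h1 | h1)
    · exact Or.inl h1.symm
    · rw [Sym2.eq_swap] at h1; exact Or.inr h1
  · constructor
    rintro p (h1 | ⟨h1, _⟩)
    · exact T'.irrefl h1
    · rcases Sym2.eq_iff.1 h1 with ⟨h2, h3⟩ | ⟨h2, h3⟩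
      · exact hab.ne (h2.symm.trans h3)
      · exact hab.ne (h3.symm.trans h2)
  · rintro p q (h1 | ⟨h1, _⟩)
    · exact ((h.old p q).1 (hT h1)).1
    · rw [← SimpleGraph.mem_edgeSet, h1]; exact hab
  · intro p q
    constructor
    · intro h1
      exact ⟨Or.inl h1, ((h.old p q).1 (hT h1)).2⟩
    · rintro ⟨h1 | h1, h2⟩
      · exact h1
      · exact absurd h1.1 h2
  · intro p
    constructor
    · intro h1
      rcases (h.new p).1 (hT h1) with rfl | ⟨rfl, h2⟩
      · exact Or.inl rfl
      · exact Or.inr ⟨rfl, Or.inr ⟨rfl, h1⟩⟩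
    · rintro (rfl | ⟨rfl, h1 | h1⟩)
      · exact hwa
      · exact absurd h1 hno
      · exact h1.2

lemma SubdivRel.unique {T : SimpleGraph X} {T' T'' : SimpleGraph X'}
    (hX : ∀ z, z = w ∨ ∃ p, z = f p)
    (h : SubdivRel f w a b T T') (h' : SubdivRel f w a b T T'') : T' = T'' :=
  le_antisymm (h.le hX h' le_rfl) (h'.le hX h le_rfl)

lemma SubdivRel.swap {H : SimpleGraph X} {H' : SimpleGraph X'} (hab : H.Adj a b)
    (h : SubdivRel f w a b H H') : SubdivRel f w b a H H' := by
  refine ⟨fun p q => ?_, fun p => ?_⟩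
  · rw [h.old, Sym2.eq_swap (a := b)]
  · rw [h.new]
    simp [hab, hab.symm, or_comm]

/-- Signed sum over spanning trees. -/
noncomputable def sx (H : SimpleGraph X) (σ : Sym2 X → ℤ) (e : Sym2 X) : ℤ :=
  ∑ᶠ T ∈ {T ∈ spanningTrees H | e ∈ T.edgeSet}, (-1 : ℤ) ^ posCount σ T

/-- Signed sum over spanning trees. -/
noncomputable def sy (H : SimpleGraph X) (σ : Sym2 X → ℤ) (e : Sym2 X) : ℤ :=
  ∑ᶠ T ∈ {T ∈ spanningTrees H | e ∉ T.edgeSet}, (-1 : ℤ) ^ posCount σ T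

lemma sx_add_sy [Finite X] (H : SimpleGraph X) (σ : Sym2 X → ℤ) (e : Sym2 X) :
    ∑ᶠ T ∈ spanningTrees H, (-1 : ℤ) ^ posCount σ T = sx H σ e + sy H σ e := by
  unfold sx sy
  rw [← finsum_mem_union]
  · congr! 3 with T
    simp only [Set.mem_union, Set.mem_ofPred_eq]
    tauto
  · rw [Set.disjoint_left]
    rintro T ⟨_, h⟩ ⟨_, h'⟩
    exact h' h
  · exact Set.toFinite _
  · exact Set.toFinite _

lemma step_x [Finite X] {H : SimpleGraph X} {H' : SimpleGraph X'}
    (hX : ∀ z, z = w ∨ ∃ p, z = f p) (hf : Function.Injective f) (hw : ∀ p, f p ≠ w)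
    (hab : H.Adj a b) (h : SubdivRel f w a b H H') (σ : Sym2 X → ℤ) (σ' : Sym2 X' → ℤ)
    (h1 : ∀ p q, σ' s(f p, f q) = σ s(p, q)) (h2 : ∀ p, σ' s(w, f p) = 1)
    (h3 : σ s(a, b) = 1) :
    sx H' σ' s(w, f a) = - (sx H σ s(a, b) + sy H σ s(a, b)) := by
  rw [← sx_add_sy]
  choose up hup using fun T : SimpleGraph X =>
    SubdivRel.exists_up (f := f) (w := w) (a := a) (b := b) T hf hw
  unfold sx
  rw [← finsum_mem_neg_distrib _ (Set.toFinite _)]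
  symm
  refine finsum_mem_eq_of_bijOn up ⟨?_, ?_, ?_⟩ ?_
  · rintro T ⟨hT, hT'⟩
    exact ⟨⟨(hup T).le hX h hT, ((hup T).isTree hX hf hw hab.ne).2 hT'⟩,
      ((hup T).new a).2 (Or.inl rfl)⟩
  · intro T _ T2 _ hh
    ext p q
    rw [(hup T).adj_iff hab.ne, (hup T2).adj_iff hab.ne, hh]
  · rintro T' ⟨⟨hT, hT'⟩, hwa⟩
    obtain ⟨T, hTH, hr⟩ := h.exists_down hab hT hwa
    exact ⟨T, ⟨hTH, (hr.isTree hX hf hw hab.ne).1 hT'⟩, (hup T).unique hX hr⟩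
  · intro T _
    rw [(hup T).posCount hX hf hw hab.ne σ σ' h1 h2 h3, pow_succ]
    ring

lemma step_y [Finite X] {H : SimpleGraph X} {H' : SimpleGraph X'}
    (hX : ∀ z, z = w ∨ ∃ p, z = f p) (hf : Function.Injective f) (hw : ∀ p, f p ≠ w)
    (hab : H.Adj a b) (h : SubdivRel f w a b H H') (σ : Sym2 X → ℤ) (σ' : Sym2 X' → ℤ)
    (h1 : ∀ p q, σ' s(f p, f q) = σ s(p, q)) (h2 : ∀ p, σ' s(w, f p) = 1)
    (h3 : σ s(a, b) = 1) :
    sy H' σ' s(w, f a) = - sy H σ s(a, b) := by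
  choose up hup using fun T : SimpleGraph X =>
    SubdivRel.exists_up (f := f) (w := w) (a := b) (b := a) T hf hw
  unfold sy
  rw [← finsum_mem_neg_distrib _ (Set.toFinite _)]
  symm
  refine finsum_mem_eq_of_bijOn up ⟨?_, ?_, ?_⟩ ?_
  · rintro T ⟨⟨hT, hT'⟩, he⟩
    refine ⟨⟨(hup T).le hX (h.swap hab) hT, ((hup T).isTree hX hf hw hab.ne.symm).2 hT'⟩, ?_⟩
    rw [SimpleGraph.mem_edgeSet, (hup T).new]
    rintro (h5 | ⟨_, h5⟩)
    · exact hab.ne h5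
    · exact he h5.symm
  · intro T _ T2 _ hh
    ext p q
    rw [(hup T).adj_iff hab.ne.symm, (hup T2).adj_iff hab.ne.symm, hh]
  · rintro T' ⟨⟨hT, hT'⟩, hwa⟩
    rw [SimpleGraph.mem_edgeSet] at hwa
    have hwb : T'.Adj w (f b) := by
      have : Nontrivial X' := ⟨⟨w, f a, (hw a).symm⟩⟩
      obtain ⟨z, hz⟩ := hT'.1.preconnected.exists_adj_of_nontrivial w
      rcases hX z with rfl | ⟨p, rfl⟩
      · exact absurd hz (T'.irrefl)
      · rcases (h.new p).1 (hT hz) with rfl | ⟨rfl, _⟩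
        · exact absurd hz hwa
        · exact hz
    obtain ⟨T, hTH, hr⟩ := (h.swap hab).exists_down hab.symm hT hwb
    refine ⟨T, ⟨⟨hTH, (hr.isTree hX hf hw hab.ne.symm).1 hT'⟩, ?_⟩, (hup T).unique hX hr⟩
    intro he
    exact hwa ((hr.new a).2 (Or.inr ⟨rfl, he.symm⟩))
  · intro T _
    rw [(hup T).posCount hX hf hw hab.ne.symm σ σ' h1 h2 (Sym2.eq_swap ▸ h3), pow_succ]
    ring

end

lemma subdiv_zero {V : Type*} (G : SimpleGraph V) (u v : V) (he : G.Adj u v) :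
    SubdivRel (Sum.inl : V → V ⊕ Fin 1) (inr 0) v u G (subdiv G u v 1) := by
  constructor
  · intro p q
    rw [Sym2.eq_swap (a := v)]
    simp only [subdiv, SimpleGraph.fromRel_adj]
    rw [Sym2.eq_swap (a := q), G.adj_comm q p]
    have := G.ne_of_adj (a := p) (b := q)
    simp only [ne_eq, Sum.inl.injEq]
    tauto
  · intro p
    simp [subdiv, SimpleGraph.fromRel_adj, he.symm, or_comm]

lemma subdiv_adj_ll {V : Type*} (G : SimpleGraph V) (u v : V) (n : ℕ) (p q : V) :
    (subdiv G u v n).Adj (inl p) (inl q) ↔ G.Adj p q ∧ s(p, q) ≠ s(u, v) := by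
  simp only [subdiv, SimpleGraph.fromRel_adj]
  rw [Sym2.eq_swap (a := q), G.adj_comm q p]
  have := G.ne_of_adj (a := p) (b := q)
  simp only [ne_eq, Sum.inl.injEq]
  tauto

lemma subdiv_adj_lr {V : Type*} (G : SimpleGraph V) (u v : V) (n : ℕ) (p : V) (i : Fin n) :
    (subdiv G u v n).Adj (inl p) (inr i) ↔
      (p = u ∧ (i : ℕ) = 0) ∨ (p = v ∧ (i : ℕ) = n - 1) := by
  simp [subdiv, SimpleGraph.fromRel_adj]

lemma subdiv_adj_rr {V : Type*} (G : SimpleGraph V) (u v : V) (n : ℕ) (i j : Fin n) :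
    (subdiv G u v n).Adj (inr i) (inr j) ↔ (j : ℕ) = i + 1 ∨ (i : ℕ) = j + 1 := by
  simp only [subdiv, SimpleGraph.fromRel_adj, ne_eq, Sum.inr.injEq, Fin.ext_iff]
  omega

lemma subdiv_succ {V : Type*} (G : SimpleGraph V) (u v : V) (n : ℕ) (he : G.Adj u v) :
    SubdivRel (Sum.map id Fin.castSucc : V ⊕ Fin (n + 1) → V ⊕ Fin (n + 2))
      (inr (Fin.last (n + 1))) (inl v) (inr (Fin.last n))
      (subdiv G u v (n + 1)) (subdiv G u v (n + 2)) := by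
  have huv := he.ne
  have hlr : ∀ (q : V) (i : Fin (n + 1)), (subdiv G u v (n + 2)).Adj (inl q) (inr i.castSucc) ↔
      (subdiv G u v (n + 1)).Adj (inl q) (inr i) ∧ ¬ (q = v ∧ i = Fin.last n) := by
    intro q i
    have := i.2
    rw [subdiv_adj_lr, subdiv_adj_lr, Fin.ext_iff, Fin.val_last, Fin.val_castSucc]
    grind
  constructor
  · rintro (p | i) (q | j)
    · simp [subdiv_adj_ll]
    · simp [hlr]
    · rw [SimpleGraph.adj_comm, SimpleGraph.adj_comm _ (inr i)]
      simp [hlr]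
      tauto
    · simp [subdiv_adj_rr]
  · rintro (p | i)
    · rw [SimpleGraph.adj_comm]
      simp [subdiv_adj_lr]
    · have := i.2
      simp only [Sum.map_inr, subdiv_adj_rr, subdiv_adj_lr, Sum.inr.injEq, Fin.ext_iff,
        Fin.val_last, Fin.val_castSucc, reduceCtorEq]
      grind

lemma sxy_formula {V : Type*} [Finite V] (G : SimpleGraph V) (σ : Sym2 V → ℤ)
    (u v : V) (he : G.Adj u v) (hsign : σ s(u, v) = 1) (n : ℕ) :
    sx (subdiv G u v (n + 1)) (subdivSign σ) s(inr (Fin.last n), inl v) =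
      (-1) ^ (n + 1) * (sx G σ s(u, v) + (n + 1) * sy G σ s(u, v)) ∧
    sy (subdiv G u v (n + 1)) (subdivSign σ) s(inr (Fin.last n), inl v) =
      (-1) ^ (n + 1) * sy G σ s(u, v) := by
  induction n with
  | zero =>
    have hX : ∀ z : V ⊕ Fin 1, z = inr 0 ∨ ∃ p, z = inl p := by
      rintro (p | i)
      · exact Or.inr ⟨p, rfl⟩
      · exact Or.inl (by rw [Subsingleton.elim i 0])
    have e1 := step_x hX Sum.inl_injective (by simp) he.symm (subdiv_zero G u v he) σ
      (subdivSign σ) (fun _ _ => rfl) (fun _ => rfl) (Sym2.eq_swap ▸ hsign)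
    have e2 := step_y hX Sum.inl_injective (by simp) he.symm (subdiv_zero G u v he) σ
      (subdivSign σ) (fun _ _ => rfl) (fun _ => rfl) (Sym2.eq_swap ▸ hsign)
    rw [Sym2.eq_swap (a := v)] at e1 e2
    constructor
    · refine e1.trans ?_
      push_cast; ring
    · refine e2.trans ?_
      ring
  | succ n ih =>
    have hX : ∀ z : V ⊕ Fin (n + 2), z = inr (Fin.last (n + 1)) ∨
        ∃ p : V ⊕ Fin (n + 1), z = Sum.map id Fin.castSucc p := by
      rintro (p | i)
      · exact Or.inr ⟨inl p, rfl⟩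
      · induction i using Fin.lastCases with
        | last => exact Or.inl rfl
        | cast i => exact Or.inr ⟨inr i, rfl⟩
    have hf : Function.Injective
        (Sum.map id Fin.castSucc : V ⊕ Fin (n + 1) → V ⊕ Fin (n + 2)) :=
      Function.Injective.sumMap Function.injective_id (Fin.castSucc_injective _)
    have hw : ∀ p : V ⊕ Fin (n + 1), Sum.map id Fin.castSucc p ≠ 
        (inr (Fin.last (n + 1)) : V ⊕ Fin (n + 2)) := by
      rintro (p | i)
      · simp
      · simp [Fin.ext_iff, i.2.ne]
    have hadj : (subdiv G u v (n + 1)).Adj (inl v) (inr (Fin.last n)) := by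
      simp [subdiv, SimpleGraph.fromRel_adj]
    have h1 : ∀ p q : V ⊕ Fin (n + 1), (subdivSign σ s((Sum.map id Fin.castSucc p :
        V ⊕ Fin (n + 2)), Sum.map id Fin.castSucc q) : ℤ) = subdivSign σ s(p, q) := by
      rintro (p | i) (q | j) <;> rfl
    have e1 := step_x hX hf hw hadj (subdiv_succ G u v n he) (subdivSign σ)
      (subdivSign σ) h1 (fun _ => rfl) rfl
    have e2 := step_y hX hf hw hadj (subdiv_succ G u v n he) (subdivSign σ)
      (subdivSign σ) h1 (fun _ => rfl) rfl
    rw [Sym2.eq_swap (a := inl v)] at e1 e2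
    constructor
    · refine e1.trans ?_
      rw [ih.1, ih.2]
      push_cast; ring
    · refine e2.trans ?_
      rw [ih.2]
      ring

lemma twistSum_formula {V : Type*} [Finite V] (G : SimpleGraph V) (σ : Sym2 V → ℤ)
    (u v : V) (he : G.Adj u v) (hsign : σ s(u, v) = 1) (n : ℕ) :
    twistSum G σ u v n = (-1) ^ n * (sx G σ s(u, v) + (n + 1) * sy G σ s(u, v)) := by
  cases n with
  | zero => simp [twistSum, sx_add_sy G σ s(u, v)]
  | succ n =>
    obtain ⟨e1, e2⟩ := sxy_formula G σ u v he hsign n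
    simp only [twistSum]
    rw [sx_add_sy _ _ s(inr (Fin.last n), inl v), e1, e2]
    push_cast; ring

lemma abs_formula (x y : ℤ) (hxy : |x + y| = |x| + |y|) (n : ℕ) :
    |(-1) ^ n * (x + (n + 1) * y)| = |x| + (n + 1) * |y| := by
  have hn : (0 : ℤ) ≤ n + 1 := by positivity
  rw [abs_mul, abs_pow, abs_neg, abs_one, one_pow, one_mul]
  rw [abs_add_eq_add_abs_iff] at hxy
  have : |x + (n + 1) * y| = |x| + |(n + 1) * y| := by
    rw [abs_add_eq_add_abs_iff]
    rcases hxy with ⟨h1, h2⟩ | ⟨h1, h2⟩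
    · exact Or.inl ⟨h1, mul_nonneg hn h2⟩
    · exact Or.inr ⟨h1, mul_nonpos_of_nonneg_of_nonpos hn h2⟩
  rw [this, abs_mul, abs_of_nonneg hn]

/-- If `x` (the sum of `(-1)^{v(T)}` over spanning trees of `G` containing
`e`) and `y` (the corresponding sum over spanning trees not containing `e`)
satisfy `|x + y| = |x| + |y|`, then for every `n ≥ 1` the absolute value of
the signed spanning-tree sum of `G^n` equals that of `G^{n-1}` plus `|y|`
(where `G^0` is interpreted as `G` itself). -/
theorem abs_twistSum_succ {V : Type*} [Fintype V] (G : SimpleGraph V)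
    (hG : G.Connected) (σ : Sym2 V → ℤ)
    (hσ : ∀ ed ∈ G.edgeSet, σ ed = 1 ∨ σ ed = -1)
    (u v : V) (he : G.Adj u v) (hsign : σ s(u, v) = 1)
    (x y : ℤ)
    (hx : x = ∑ᶠ T ∈ {T ∈ spanningTrees G | s(u, v) ∈ T.edgeSet},
        (-1 : ℤ) ^ posCount σ T)
    (hy : y = ∑ᶠ T ∈ {T ∈ spanningTrees G | s(u, v) ∉ T.edgeSet},
        (-1 : ℤ) ^ posCount σ T)
    (hxy : |x + y| = |x| + |y|) :
    ∀ n : ℕ, 1 ≤ n →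
      |twistSum G σ u v n| = |twistSum G σ u v (n - 1)| + |y| := by
  intro n hn
  obtain ⟨m, rfl⟩ : ∃ m, n = m + 1 := ⟨n - 1, by omega⟩
  rw [Nat.add_sub_cancel, twistSum_formula G σ u v he hsign, twistSum_formula G σ u v he hsign]
  change x = sx G σ s(u, v) at hx
  change y = sy G σ s(u, v) at hy
  rw [← hx, ← hy, abs_formula x y hxy, abs_formula x y hxy]
  push_cast
  ring
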